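/- Let μ be a finite measure on ℝ^d with ∫‖x‖² dμ(x) < ∞, let y₁, …, y_k ∈ ℝ^d, W = (w₁,…,w_k) ∈ ℝ^k, w_M = max_i w_i, and ŷ_i = (y_i, √(w_M − w_i)) ∈ ℝ^d × ℝ. Then ∫ min_{1≤i≤k} ‖(x,0) − ŷ_i‖² dμ(x) = ∫ min_{1≤i≤k} (‖x − y_i‖² − w_i) dμ(x) + w_M · μ(ℝ^d); that is, the lifted quantization noise power Q̂ equals F(W) plus the constant w_M μ(Ω), where F(W) is the transport term of the objective function of semi-discrete optimal transport. -/

import Mathlib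

open MeasureTheory

/-- The pointwise infimum of a finite nonempty family of integrable functions is integrable. -/
theorem integrable_iInf_of_finite {α ι : Type*} [MeasurableSpace α] {μ : Measure α}
    [Finite ι] [Nonempty ι] {f : ι → α → ℝ} (hf : ∀ i, Integrable (f i) μ) :
    Integrable (fun x => ⨅ i, f i x) μ := by
  have := Fintype.ofFinite ι
  refine (integrable_finsetSum Finset.univ fun i _ => (hf i).norm).mono'
    (AEMeasurable.iInf fun i => (hf i).aemeasurable).aestronglyMeasurable
    (Filter.Eventually.of_forall fun x => ?_)
  obtain ⟨i, hi⟩ := exists_eq_ciInf_of_finite (f := fun i => f i x)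
  rw [← hi]
  exact Finset.single_le_sum (f := fun i => ‖f i x‖) (fun _ _ => norm_nonneg _)
    (Finset.mem_univ i)

/-- A finite measure with finite second moment about the origin has finite second moment about
every point. -/
theorem integrable_norm_sub_sq {E : Type*} [NormedAddCommGroup E] [SecondCountableTopology E]
    [MeasurableSpace E] [OpensMeasurableSpace E] {μ : Measure E} [IsFiniteMeasure μ]
    (h : Integrable (fun x => ‖x‖ ^ 2) μ) (y : E) :
    Integrable (fun x => ‖x - y‖ ^ 2) μ := by
  have hid : AEStronglyMeasurable (fun x : E => x) μ := continuous_id.aestronglyMeasurable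
  have hL : MemLp (fun x : E => x - y) 2 μ :=
    ((memLp_two_iff_integrable_sq_norm hid).2 h).sub (memLp_const y)
  exact (memLp_two_iff_integrable_sq_norm hL.1).1 hL

/-- The lifted quantization noise power `Q̂` equals the transport term `F(W)` of the
semi-discrete optimal transport objective plus the constant `w_M μ(Ω)`. -/
theorem lifted_quantization_eq_transport_term
    (d k : ℕ) (μ : Measure (EuclideanSpace ℝ (Fin d))) [IsFiniteMeasure μ]
    (hint : Integrable (fun x => ‖x‖ ^ 2) μ)
    (y : Fin k → EuclideanSpace ℝ (Fin d)) (w : Fin k → ℝ)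
    (wM : ℝ) (hwM : IsGreatest (Set.range w) wM) :
    ∫ x, (⨅ i : Fin k,
        ‖(WithLp.equiv 2 (EuclideanSpace ℝ (Fin d) × ℝ)).symm (x, (0 : ℝ)) -
          (WithLp.equiv 2 (EuclideanSpace ℝ (Fin d) × ℝ)).symm
            (y i, Real.sqrt (wM - w i))‖ ^ 2) ∂μ =
      (∫ x, (⨅ i : Fin k, (‖x - y i‖ ^ 2 - w i)) ∂μ) + wM * (μ Set.univ).toReal := by
  obtain ⟨i₀, -⟩ := hwM.1
  have : Nonempty (Fin k) := ⟨i₀⟩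
  have hpt (x : EuclideanSpace ℝ (Fin d)) (i : Fin k) :
      ‖(WithLp.equiv 2 (EuclideanSpace ℝ (Fin d) × ℝ)).symm (x, (0 : ℝ)) -
        (WithLp.equiv 2 (EuclideanSpace ℝ (Fin d) × ℝ)).symm
          (y i, Real.sqrt (wM - w i))‖ ^ 2 = (‖x - y i‖ ^ 2 - w i) + wM := by
    have hle : 0 ≤ wM - w i := sub_nonneg.2 (hwM.2 ⟨i, rfl⟩)
    rw [WithLp.prod_norm_sq_eq_of_L2]
    simp [Real.sq_sqrt hle]
    ring
  have hF : Integrable (fun x => ⨅ i : Fin k, (‖x - y i‖ ^ 2 - w i)) μ :=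
    integrable_iInf_of_finite fun i =>
      (integrable_norm_sub_sq hint (y i)).sub (integrable_const (w i))
  simp_rw [hpt, ← ciInf_add (Set.finite_range _).bddBelow]
  rw [integral_add hF (integrable_const wM), integral_const, smul_eq_mul, mul_comm wM,
    Measure.real]
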